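/- Let k be a field, n ≤ 3, 1 ≤ d ≤ n, B = k[x₁^{±1}, …, x_d^{±1}, x_{d+1}, …, xₙ], and A a k-subalgebra of B which is a k-retract of B. Then the fraction field Q(A) of A is rational over k, i.e., Q(A) is k-isomorphic to the field of rational functions k(t₁, …, t_m) in m = tr.deg_k A variables over k. -/

import Mathlib

/-- The transcendence degree of a `k`-algebra `A`: the supremum of the cardinalities of
algebraically independent subsets of `A` over `k`.  For an integral domain `A` this equals
the transcendence degree of `Q(A)` over `k`. -/
noncomputable def trdeg (k A : Type*) [CommRing k] [CommRing A] [Algebra k A] : Cardinal :=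
  ⨆ s : { s : Set A // AlgebraicIndependent k ((↑) : s → A) }, Cardinal.mk s.1

/-- The mixed Laurent/polynomial ring `k[x₁^{±1}, …, x_d^{±1}, x_{d+1}, …, x_{d+m}]`,
realized as the monoid algebra of `ℤ^d × ℕ^m` over `k`. -/
abbrev MixedLaurent (k : Type*) [CommRing k] (d m : ℕ) : Type _ :=
  AddMonoidAlgebra k ((Fin d → ℤ) × (Fin m → ℕ))

open IntermediateField

theorem trdeg_eq_algebra_trdeg (k A : Type*) [CommRing k] [CommRing A] [Algebra k A] :
    trdeg k A = Algebra.trdeg k A := rfl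

/-- If the fraction field of a domain `A` is generated by at most `trdeg k A` elements, then it is
a rational function field. -/
theorem exists_fractionRing_equiv_of_adjoin_eq_top {k A ι : Type*} [Field k] [CommRing A]
    [IsDomain A] [Algebra k A] [Finite ι] (x : ι → FractionRing A)
    (hx : adjoin k (Set.range x) = ⊤) (hcard : (Nat.card ι : Cardinal) ≤ trdeg k A) :
    ∃ t : ℕ, (t : Cardinal) = trdeg k A ∧
      Nonempty (FractionRing A ≃ₐ[k] FractionRing (MvPolynomial (Fin t) k)) := by
  have htr : trdeg k A = Algebra.trdeg k (FractionRing A) := by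
    obtain ⟨s, hs⟩ := exists_isTranscendenceBasis k A
    have := IsLocalization.isAlgebraic (FractionRing A) (nonZeroDivisors A)
    have := (IsTranscendenceBasis.algebraMap_comp (A := FractionRing A) hs).cardinalMk_eq_trdeg
    rw [← this, hs.cardinalMk_eq_trdeg]
    rfl
  have halg : Algebra.IsAlgebraic (Algebra.adjoin k (Set.range x)) (FractionRing A) := by
    rw [← isAlgebraic_adjoin_iff_top, hx]
    exact ⟨fun a => isAlgebraic_algebraMap (⟨a, mem_top⟩ : (⊤ : IntermediateField k _))⟩
  let e : Fin (Nat.card ι) ≃ ι := (Finite.equivFin ι).symm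
  have hr : Set.range (x ∘ e) = Set.range x := e.surjective.range_comp x
  rw [← hr] at halg hx
  have hb : IsTranscendenceBasis k (x ∘ e) := by
    apply Algebra.IsAlgebraic.isTranscendenceBasis_of_lift_le_trdeg_of_finite
    rw [← htr]
    simpa using hcard
  refine ⟨Nat.card ι, ?_, ⟨?_⟩⟩
  · rw [htr]
    simpa using hb.lift_cardinalMk_eq_trdeg
  · exact ((hb.1.aevalEquivField.trans (IntermediateField.equivOfEq hx)).trans
      IntermediateField.topEquiv).symm

theorem injective_of_isTranscendenceBasis {k A L ι : Type*} [Field k] [CommRing A] [IsDomain A]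
    [CommRing L] [Algebra k A] [Algebra k L] (f : A →ₐ[k] L) {x : ι → A}
    (hx : IsTranscendenceBasis k x) (hf : AlgebraicIndependent k (f ∘ x)) :
    Function.Injective f := by
  rw [injective_iff_map_eq_zero]
  intro a ha
  by_contra ha0
  have := hx.isAlgebraic
  have h := Ideal.comap_ne_bot_of_algebraic_mem (I := RingHom.ker f.toRingHom) ha0 ha
    (this.isAlgebraic a)
  apply h
  rw [eq_bot_iff]
  rintro ⟨b, hb⟩ hb0
  rw [Algebra.adjoin_range_eq_range_aeval] at hb
  obtain ⟨p, rfl⟩ := hb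
  have h0 : f (MvPolynomial.aeval x p) = 0 := hb0
  have hp : p = 0 := by
    apply hf.eq_zero_of_aeval_eq_zero
    rw [← h0, ← AlgHom.comp_apply, MvPolynomial.comp_aeval]
    rfl
  subst hp
  exact Subtype.ext (map_zero (MvPolynomial.aeval x))

/-- A form of Lüroth's theorem: a domain mapping to `K(X)` in such a way that its image contains
generators of the purely transcendental extension `K` of `k` and a nonconstant function has a
rational fraction field, provided that its transcendence degree is small enough for the map to be
injective. -/
theorem exists_fractionRing_equiv_of_algHom_ratFunc {k A K ι : Type*} [Field k] [CommRing A]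
    [IsDomain A] [Algebra k A] [Field K] [Algebra k K] [Finite ι] (f : A →ₐ[k] RatFunc K)
    (y : ι → A) (z : ι → K) (hyz : ∀ i, f (y i) = RatFunc.C (z i))
    (hz : AlgebraicIndependent k z) (htop : adjoin k (Set.range z) = ⊤)
    (a : A) (ha : ¬ ∃ c, f a = RatFunc.C c) (htr : trdeg k A ≤ Nat.card ι + 1) :
    ∃ t : ℕ, (t : Cardinal) = trdeg k A ∧
      Nonempty (FractionRing A ≃ₐ[k] FractionRing (MvPolynomial (Fin t) k)) := by
  have hfa : Transcendental K (f a) := RatFunc.transcendental_of_ne_C _ ha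
  have hy : f ∘ y = IsScalarTower.toAlgHom k K (RatFunc K) ∘ z := funext hyz
  have hfy : AlgebraicIndependent k (f ∘ y) := by
    rw [hy]
    exact hz.map' (FaithfulSMul.algebraMap_injective K (RatFunc K))
  have hind : AlgebraicIndependent k (f ∘ fun o : Option ι => o.elim a y) := by
    have : (f ∘ fun o : Option ι => o.elim a y) = fun o : Option ι => o.elim (f a) (f ∘ y) := by
      ext o; cases o <;> rfl
    rw [this, hfy.option_iff_transcendental]
    let j := IsScalarTower.toAlgHom k K (RatFunc K)
    have hj : Function.Injective j := FaithfulSMul.algebraMap_injective K (RatFunc K)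
    have hle : Algebra.adjoin k (Set.range (f ∘ y)) ≤ j.range := by
      rw [Algebra.adjoin_le_iff]
      rintro _ ⟨i, rfl⟩
      exact ⟨z i, (hyz i).symm⟩
    let e := (AlgEquiv.ofInjective j hj).symm
    intro halg
    refine hfa ((halg.tower_top_of_subalgebra_le hle).ringHom_of_comp_eq e
      (RingHom.id (RatFunc K)) e.injective ?_)
    ext r
    exact congrArg Subtype.val ((AlgEquiv.ofInjective j hj).apply_symm_apply r)
  have hb : IsTranscendenceBasis k fun o : Option ι => o.elim a y := by
    have := Fintype.ofFinite ι
    apply (hind.of_comp f).isTranscendenceBasis_of_lift_trdeg_le_of_finite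
    have := Cardinal.lift_le.2 htr
    simpa [trdeg_eq_algebra_trdeg] using this
  have hinj := injective_of_isTranscendenceBasis f hb hind
  let g : FractionRing A →ₐ[k] RatFunc K := IsFractionRing.liftAlgHom hinj
  have hg : ∀ b, g (algebraMap A _ b) = f b := fun b => by
    simp [g, IsFractionRing.liftAlgHom_apply]
  have hK : ∀ T : IntermediateField k (RatFunc K), (∀ i, f (y i) ∈ T) → ∀ c : K,
      RatFunc.C c ∈ T := by
    intro T hT c
    have : adjoin k (Set.range z) ≤ T.comap (IsScalarTower.toAlgHom k K (RatFunc K)) := by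
      rw [adjoin_le_iff]
      rintro _ ⟨i, rfl⟩
      have := hT i
      rwa [hyz] at this
    exact this (htop ▸ mem_top)
  let E : IntermediateField K (RatFunc K) :=
    g.fieldRange.toSubfield.toIntermediateField (hK _ fun i => ⟨_, hg (y i)⟩)
  obtain ⟨w, hw⟩ : RatFunc.Luroth.generator E ∈ g.fieldRange :=
    RatFunc.Luroth.generator_mem (E := E)
  let x : Option ι → FractionRing A := fun o => o.elim w fun i => algebraMap A _ (y i)
  have hx : ∀ o, x o ∈ adjoin k (Set.range x) := fun o => subset_adjoin k _ ⟨o, rfl⟩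
  apply exists_fractionRing_equiv_of_adjoin_eq_top x
  · rw [eq_top_iff]
    intro u _
    let T := (adjoin k (Set.range x)).map g
    let E' : IntermediateField K (RatFunc K) :=
      T.toSubfield.toIntermediateField (hK T fun i => ⟨_, hx (some i), hg (y i)⟩)
    have hE : E ≤ E' := by
      rw [RatFunc.Luroth.eq_adjoin_generator (E := E), adjoin_simple_le_iff]
      exact ⟨w, hx none, hw⟩
    obtain ⟨u', hu', h⟩ := hE (show g u ∈ E from ⟨u, rfl⟩)
    rwa [← g.injective h]
  · have := Fintype.ofFinite ι
    have := (hind.of_comp f).lift_cardinalMk_le_trdeg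
    simpa [trdeg_eq_algebra_trdeg, -Order.add_one_le_iff] using this

theorem exists_addMonoidHom_int_forall_ne_zero {ι : Type*} (T : Finset (ι → ℤ)) (hT : 0 ∉ T) :
    ∃ μ : (ι → ℤ) →+ ℤ, ∀ t ∈ T, μ t ≠ 0 := by
  classical
  induction T using Finset.induction with
  | empty => exact ⟨0, by simp⟩
  | insert t T ht ih =>
    obtain ⟨μ, hμ⟩ := ih fun h => hT (Finset.mem_insert_of_mem h)
    by_cases hμt : μ t = 0
    · obtain ⟨i, hi⟩ : ∃ i, t i ≠ 0 := by
        by_contra! h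
        exact hT (Finset.mem_insert.2 (Or.inl (funext h).symm))
      refine ⟨(1 + ∑ s ∈ T, |s i|) • μ + Pi.evalAddMonoidHom _ i, fun s hs => ?_⟩
      obtain rfl | hs := Finset.mem_insert.1 hs
      · simpa [hμt]
      · have hle : |s i| ≤ ∑ s ∈ T, |s i| :=
          Finset.single_le_sum (f := fun s : ι → ℤ => |s i|) (fun _ _ => abs_nonneg _) hs
        have h1 := Int.one_le_abs (hμ s hs)
        intro h
        have h2 : (1 + ∑ s ∈ T, |s i|) * μ s = - s i := by
          simpa [add_eq_zero_iff_eq_neg] using h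
        have h3 := congrArg abs h2
        rw [abs_mul, abs_neg, abs_of_pos (by linarith [abs_nonneg (s i)])] at h3
        nlinarith [abs_nonneg (s i)]
    · exact ⟨μ, fun s hs => by
        obtain rfl | hs := Finset.mem_insert.1 hs
        exacts [hμt, hμ s hs]⟩

theorem exists_addMonoidHom_int_separating {M ι : Type*} [AddCommMonoid M] (q : M →+ (ι → ℤ))
    (S : Finset M) :
    ∃ l : M →+ ℤ, (∀ e, q e = 0 → l e = 0) ∧ ∀ e ∈ S, ∀ e' ∈ S, l e = l e' → q e = q e' := by
  classical
  obtain ⟨μ, hμ⟩ := exists_addMonoidHom_int_forall_ne_zero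
    (((S ×ˢ S).image fun p => q p.1 - q p.2).erase 0) (by simp)
  refine ⟨μ.comp q, fun e he => by simp [he], fun e he e' he' h => ?_⟩
  by_contra hne
  refine hμ (q e - q e') ?_ (by simpa [sub_eq_zero] using h)
  rw [Finset.mem_erase, Finset.mem_image]
  exact ⟨sub_ne_zero.2 hne, (e, e'), by simp [he, he'], rfl⟩

open scoped RatFunc LaurentSeries in
theorem ratFunc_coeff_sum_C_mul_X_zpow {K M : Type*} [Field K] (S : Finset M) (c : M → K)
    (l : M → ℤ) (j : ℤ) :
    (algebraMap (RatFunc K) (LaurentSeries K)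
      (∑ e ∈ S, RatFunc.C (c e) * RatFunc.X ^ l e)).coeff j = ∑ e ∈ S with l e = j, c e := by
  classical
  have hC : ∀ a : K, algebraMap (RatFunc K) (LaurentSeries K) (RatFunc.C a) = HahnSeries.C a := by
    intro a
    rw [← RatFunc.algebraMap_C, ← IsScalarTower.algebraMap_apply]
    simp
  rw [map_sum, HahnSeries.coeff_sum, Finset.sum_filter]
  refine Finset.sum_congr rfl fun e _ => ?_
  rw [map_mul, map_zpow₀, hC, RatFunc.coe_X, ← RatFunc.single_zpow, HahnSeries.C_mul_eq_smul,
    HahnSeries.coeff_smul, HahnSeries.coeff_single]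
  simp [eq_comm]

section Monomial

variable {k K M : Type*} [Field k] [Field K] [Algebra k K] [AddCommMonoid M]

/-- The homomorphism `k[M] → K(X)` given on monomials by `x^e ↦ χ(e) X^{l(e)}`. -/
noncomputable def monomialAlgHom (k : Type*) [Field k] [Algebra k K] (χ : Multiplicative M →* K)
    (l : M →+ ℤ) : AddMonoidAlgebra k M →ₐ[k] RatFunc K :=
  AddMonoidAlgebra.lift k (RatFunc K) M
    { toFun := fun e => RatFunc.C (χ e) * RatFunc.X ^ l e.toAdd
      map_one' := by simp
      map_mul' := fun a b => by
        rw [toAdd_mul, map_add, zpow_add₀ RatFunc.X_ne_zero, map_mul, map_mul]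
        ring }

theorem monomialAlgHom_single (χ : Multiplicative M →* K) (l : M →+ ℤ) (e : M) :
    monomialAlgHom k χ l (AddMonoidAlgebra.single e 1) =
      RatFunc.C (χ (Multiplicative.ofAdd e)) * RatFunc.X ^ l e := by
  simp [monomialAlgHom]

theorem monomialAlgHom_apply (χ : Multiplicative M →* K) (l : M →+ ℤ) (f : AddMonoidAlgebra k M) :
    monomialAlgHom k χ l f = ∑ e ∈ f.coeff.support,
      RatFunc.C (algebraMap k K (f.coeff e) * χ (Multiplicative.ofAdd e)) * RatFunc.X ^ l e := by
  rw [monomialAlgHom, AddMonoidAlgebra.lift_apply, Finsupp.sum]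
  refine Finset.sum_congr rfl fun e _ => ?_
  rw [Algebra.smul_def, IsScalarTower.algebraMap_apply k K (RatFunc K), map_mul, mul_assoc]
  rfl

theorem monomialAlgHom_ne_C (χ : Multiplicative M →* K) (l : M →+ ℤ) (f : AddMonoidAlgebra k M)
    (j : ℤ) (hj : j ≠ 0)
    (hf : ∑ e ∈ f.coeff.support with l e = j,
      algebraMap k K (f.coeff e) * χ (Multiplicative.ofAdd e) ≠ 0) :
    ¬ ∃ c, monomialAlgHom k χ l f = RatFunc.C c := by
  rintro ⟨c, hc⟩
  apply hf
  rw [← ratFunc_coeff_sum_C_mul_X_zpow, ← monomialAlgHom_apply, hc]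
  have := ratFunc_coeff_sum_C_mul_X_zpow ({()} : Finset Unit) (fun _ => c) 0 j
  simpa [hj.symm] using this

end Monomial

theorem exists_eq_nsmul_of_ne_zero {ι : Type*} [Fintype ι] (u : ι → ℤ) (hu : u ≠ 0) :
    ∃ (g : ℕ) (v a : ι → ℤ), g ≠ 0 ∧ u = g • v ∧ ∑ i, v i * a i = 1 := by
  obtain ⟨i, hi⟩ := Function.ne_iff.1 hu
  obtain ⟨v, hv, hv1⟩ := Finset.univ.extract_gcd u ⟨i, Finset.mem_univ i⟩
  obtain ⟨a, ha⟩ := Finset.univ.gcd_eq_sum_mul v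
  have h0 : Finset.univ.gcd u ≠ 0 := fun h =>
    hi (Finset.gcd_eq_zero_iff.1 h i (Finset.mem_univ i))
  have hnonneg : 0 ≤ Finset.univ.gcd u := by
    rw [← Finset.normalize_gcd]
    exact Int.nonneg_of_normalize_eq_self (normalize_idem _)
  refine ⟨(Finset.univ.gcd u).toNat, v, a, by omega, ?_, by rw [← ha, hv1]⟩
  ext j
  rw [Pi.smul_apply, nsmul_eq_mul, Int.toNat_of_nonneg hnonneg]
  exact hv j (Finset.mem_univ j)

theorem AddMonoidAlgebra.exists_eq_single_of_mul_eq_one {k M : Type*} [Field k]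
    [AddCommMonoid M] [TwoUniqueSums M] {f g : AddMonoidAlgebra k M} (h : f * g = 1) :
    ∃ e e' c, e + e' = 0 ∧ c ≠ 0 ∧ f = single e c := by
  have hf : f ≠ 0 := by rintro rfl; simp at h
  have hg : g ≠ 0 := by rintro rfl; simp at h
  have hf' : f.coeff.support.Nonempty := by simpa using hf
  have hg' : g.coeff.support.Nonempty := by simpa using hg
  have key : ∀ a ∈ f.coeff.support, ∀ b ∈ g.coeff.support,
      UniqueAdd f.coeff.support g.coeff.support a b → a + b = 0 := by
    intro a ha b hb hu
    by_contra hab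
    have := AddMonoidAlgebra.coeff_mul_add_of_uniqueAdd hu
    rw [h, AddMonoidAlgebra.one_def, AddMonoidAlgebra.coeff_single,
      Finsupp.single_eq_of_ne hab] at this
    exact mul_ne_zero (Finsupp.mem_support_iff.1 ha) (Finsupp.mem_support_iff.1 hb) this.symm
  have hcard : f.coeff.support.card * g.coeff.support.card ≤ 1 := by
    by_contra! hlt
    obtain ⟨p, hp, p', hp', hne, hu, hu'⟩ := TwoUniqueSums.uniqueAdd_of_one_lt_card hlt
    rw [Finset.mem_product] at hp hp'
    have h1 := key _ hp.1 _ hp.2 hu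
    have h2 := key _ hp'.1 _ hp'.2 hu'
    obtain ⟨h3, h4⟩ := hu hp'.1 hp'.2 (h2.trans h1.symm)
    exact hne (Prod.ext h3.symm h4.symm)
  have hfc := hf'.card_pos
  have hgc := hg'.card_pos
  have hf1 : f.coeff.support.card = 1 := by nlinarith
  have hg1 : g.coeff.support.card = 1 := by nlinarith
  obtain ⟨e, he, hfe⟩ := Finsupp.card_support_eq_one.1 hf1
  obtain ⟨e', he', hge⟩ := Finsupp.card_support_eq_one.1 hg1
  refine ⟨e, e', f.coeff e, ?_, he, by ext1; simpa using hfe⟩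
  refine key e (Finsupp.mem_support_iff.2 he) e' (Finsupp.mem_support_iff.2 he') ?_
  intro a b ha hb _
  rw [hfe] at ha
  rw [hge] at hb
  exact ⟨Finset.mem_singleton.1 (Finsupp.support_single_subset ha),
    Finset.mem_singleton.1 (Finsupp.support_single_subset hb)⟩

theorem IntermediateField.eq_top_of_forall_algebraMap_mem {k A : Type*} [Field k] [CommRing A]
    [IsDomain A] [Algebra k A] (E : IntermediateField k (FractionRing A))
    (hE : ∀ a : A, algebraMap A _ a ∈ E) : E = ⊤ := by
  rw [eq_top_iff]
  intro u _
  obtain ⟨a, b, _, rfl⟩ := IsFractionRing.div_surjective (A := A) u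
  exact div_mem (hE a) (hE b)

namespace MixedLaurent

variable {k : Type*} [Field k] {d m : ℕ}

theorem exists_eq_single_of_mul_eq_one {f g : MixedLaurent k d m} (h : f * g = 1) :
    ∃ (u : Fin d → ℤ) (c : k), c ≠ 0 ∧ f = AddMonoidAlgebra.single (u, 0) c := by
  obtain ⟨⟨u, b⟩, e', c, he, hc, rfl⟩ := AddMonoidAlgebra.exists_eq_single_of_mul_eq_one h
  have hb : b = 0 := by
    ext i
    have := congrFun (congrArg Prod.snd he) i
    simp at this
    exact this.1
  exact ⟨u, c, hc, by rw [hb]⟩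

/-- The exponents of mixed Laurent monomials, viewed as integer vectors. -/
def exponentHom (d m : ℕ) : ((Fin d → ℤ) × (Fin m → ℕ)) →+ (Fin d ⊕ Fin m → ℤ) where
  toFun e := Sum.elim e.1 fun i => (e.2 i : ℤ)
  map_zero' := by ext (i | i) <;> simp
  map_add' _ _ := by ext (i | i) <;> simp

theorem exponentHom_injective (d m : ℕ) : Function.Injective (exponentHom d m) := by
  intro e e' h
  refine Prod.ext (funext fun i => congrFun h (Sum.inl i)) (funext fun i => ?_)
  exact Nat.cast_injective (R := ℤ) (congrFun h (Sum.inr i))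

/-- The exponents of the variables. -/
def varExponent (d m : ℕ) : Fin d ⊕ Fin m → (Fin d → ℤ) × (Fin m → ℕ) :=
  Sum.elim (fun i => (Pi.single i 1, 0)) fun i => (0, Pi.single i 1)

section Generation

variable {F : Type*} [Field F] [Algebra k F] (g : MixedLaurent k d m →ₐ[k] F)
  (E : IntermediateField k F)

theorem single_zsmul_mem (w : Fin d → ℤ) (hw : g (AddMonoidAlgebra.single (w, 0) 1) ∈ E) (n : ℤ) :
    g (AddMonoidAlgebra.single (n • w, 0) 1) ∈ E := by
  have hpow : ∀ n : ℕ, g (AddMonoidAlgebra.single ((n : ℤ) • w, 0) 1) ∈ E := by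
    intro n
    have := pow_mem hw n
    rw [← map_pow, AddMonoidAlgebra.single_pow] at this
    simpa using this
  obtain ⟨n, rfl | rfl⟩ := n.eq_nat_or_neg
  · exact hpow n
  · have : g (AddMonoidAlgebra.single (-(n : ℤ) • w, 0) 1) *
        g (AddMonoidAlgebra.single ((n : ℤ) • w, 0) 1) = 1 := by
      rw [← map_mul, AddMonoidAlgebra.single_mul_single, Prod.mk_add_mk, neg_smul,
        neg_add_cancel, add_zero, mul_one]
      exact map_one g
    rw [eq_inv_of_mul_eq_one_left this]
    exact inv_mem (hpow n)

theorem map_mem_of_support (f : MixedLaurent k d m)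
    (hf : ∀ e ∈ f.coeff.support, g (AddMonoidAlgebra.single e 1) ∈ E) : g f ∈ E := by
  rw [← AddMonoidAlgebra.sum_coeff_single f, Finsupp.sum, map_sum]
  refine sum_mem fun e he => ?_
  have : AddMonoidAlgebra.single e (f.coeff e) = f.coeff e • AddMonoidAlgebra.single e (1 : k) := by
    simp
  rw [this, map_smul]
  exact E.smul_mem (hf e he)

theorem map_mem_of_varExponent
    (hg : ∀ i, g (AddMonoidAlgebra.single (varExponent d m i) 1) ∈ E) (f : MixedLaurent k d m) :
    g f ∈ E := by
  let S : AddSubmonoid ((Fin d → ℤ) × (Fin m → ℕ)) :=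
    { carrier := {e | g (AddMonoidAlgebra.single e 1) ∈ E}
      zero_mem' := by
        have : g 1 ∈ E := by simp
        exact this
      add_mem' := fun {a b} ha hb => by
        have := mul_mem (S := IntermediateField k F) ha hb
        rwa [← map_mul, AddMonoidAlgebra.single_mul_single, mul_one] at this }
  refine map_mem_of_support g E f fun e _ => ?_
  change e ∈ S
  have h1 : ∀ w : Fin d → ℤ, AddMonoidHom.inl _ _ w ∈ S := by
    intro w
    rw [← Finset.univ_sum_single w, map_sum]
    refine sum_mem fun i _ => ?_
    have := single_zsmul_mem g E _ (hg (Sum.inl i)) (w i)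
    rwa [← Pi.single_smul, smul_eq_mul, mul_one] at this
  have h2 : ∀ b : Fin m → ℕ, AddMonoidHom.inr _ _ b ∈ S := by
    intro b
    rw [← Finset.univ_sum_single b, map_sum]
    refine sum_mem fun i _ => ?_
    have := nsmul_mem (show varExponent d m (Sum.inr i) ∈ S from hg (Sum.inr i)) (b i)
    simpa [varExponent, ← Pi.single_smul] using this
  simpa using add_mem (h1 e.1) (h2 e.2)

end Generation

theorem retract_eq_top_of_varExponent {A : Subalgebra k (MixedLaurent k d m)}
    (φ : MixedLaurent k d m →ₐ[k] A) (hφ : ∀ a : A, φ (a : MixedLaurent k d m) = a)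
    (E : IntermediateField k (FractionRing A))
    (hE : ∀ i, algebraMap A _ (φ (AddMonoidAlgebra.single (varExponent d m i) 1)) ∈ E) :
    E = ⊤ := by
  refine eq_top_of_forall_algebraMap_mem E fun a => ?_
  rw [← hφ a]
  exact map_mem_of_varExponent ((IsScalarTower.toAlgHom k A (FractionRing A)).comp φ) E hE _

end MixedLaurent

theorem MixedLaurent.exists_single_mem {k : Type*} [Field k] {d m : ℕ}
    {A : Subalgebra k (MixedLaurent k d m)} (φ : MixedLaurent k d m →ₐ[k] A)
    (hφ : ∀ a : A, φ (a : MixedLaurent k d m) = a) (w : Fin d → ℤ)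
    (hw : ∀ c : k, φ (AddMonoidAlgebra.single (w, 0) 1) ≠ algebraMap k A c) :
    ∃ v a : Fin d → ℤ, ∑ i, v i * a i = 1 ∧
      (AddMonoidAlgebra.single (v, 0) 1 : MixedLaurent k d m) ∈ A := by
  have hunit : ∀ w : Fin d → ℤ, ∃ (u : Fin d → ℤ) (c : k), c ≠ 0 ∧
      (φ (AddMonoidAlgebra.single (w, 0) 1) : MixedLaurent k d m) =
        AddMonoidAlgebra.single (u, 0) c := by
    intro w
    apply exists_eq_single_of_mul_eq_one
      (g := (φ (AddMonoidAlgebra.single (-w, 0) 1) : MixedLaurent k d m))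
    have : φ (AddMonoidAlgebra.single (w, 0) 1 * AddMonoidAlgebra.single (-w, 0) 1) = 1 := by
      rw [AddMonoidAlgebra.single_mul_single, Prod.mk_add_mk, add_neg_cancel, add_zero, mul_one]
      exact map_one φ
    rw [map_mul] at this
    exact congrArg Subtype.val this
  have hmem : ∀ (u : Fin d → ℤ) (c : k), c ≠ 0 →
      (AddMonoidAlgebra.single (u, 0) c : MixedLaurent k d m) ∈ A →
      (AddMonoidAlgebra.single (u, 0) 1 : MixedLaurent k d m) ∈ A := by
    intro u c hc h
    have := A.smul_mem h c⁻¹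
    rwa [AddMonoidAlgebra.smul_single, smul_eq_mul, inv_mul_cancel₀ hc] at this
  obtain ⟨u, c, hc, hu⟩ := hunit w
  have hu0 : u ≠ 0 := by
    rintro rfl
    exact hw c (Subtype.ext hu)
  have huA := hmem u c hc (hu ▸ (φ (AddMonoidAlgebra.single (w, 0) 1)).2)
  obtain ⟨g, v, a, hg, rfl, hva⟩ := exists_eq_nsmul_of_ne_zero u hu0
  refine ⟨v, a, hva, ?_⟩
  obtain ⟨v', c', hc', hv'⟩ := hunit v
  have hpow : (φ (AddMonoidAlgebra.single (v, 0) 1 ^ g) : MixedLaurent k d m) =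
      AddMonoidAlgebra.single (g • v', 0) (c' ^ g) := by
    rw [map_pow, SubmonoidClass.coe_pow, hv', AddMonoidAlgebra.single_pow]
    simp
  have hpow' : (AddMonoidAlgebra.single (v, 0) 1 : MixedLaurent k d m) ^ g =
      AddMonoidAlgebra.single (g • v, 0) 1 := by
    rw [AddMonoidAlgebra.single_pow]
    simp
  rw [hpow', hφ ⟨_, huA⟩, AddMonoidAlgebra.single_inj] at hpow
  have hvv : v = v' := by
    obtain ⟨h, -⟩ | ⟨h, -⟩ := hpow
    · exact smul_right_injective _ hg (congrArg Prod.fst h)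
    · exact absurd h one_ne_zero
  subst hvv
  exact hmem v c' hc' (hv' ▸ (φ (AddMonoidAlgebra.single (v, 0) 1)).2)

theorem MixedLaurent.exists_fractionRing_equiv_of_trdeg_le_one {k : Type*} [Field k] {d m : ℕ}
    (A : Subalgebra k (MixedLaurent k d m)) (htr : trdeg k A ≤ 1) :
    ∃ t : ℕ, (t : Cardinal) = trdeg k A ∧
      Nonempty (FractionRing A ≃ₐ[k] FractionRing (MvPolynomial (Fin t) k)) := by
  by_cases hA : ∀ f : A, ∀ e ∈ (f : MixedLaurent k d m).coeff.support, e = 0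
  · refine exists_fractionRing_equiv_of_adjoin_eq_top (ι := Empty) (fun i => i.elim) ?_ (by simp)
    refine eq_top_of_forall_algebraMap_mem _ fun f => ?_
    have : f = algebraMap k A ((f : MixedLaurent k d m).coeff 0) := by
      ext e
      by_cases he : e = 0
      · subst he; simp
      · have h := mt (hA f e) he
        rw [Finsupp.notMem_support_iff] at h
        simp [h, Ne.symm he]
    rw [this, ← IsScalarTower.algebraMap_apply]
    exact IntermediateField.algebraMap_mem _ _
  · push Not at hA
    obtain ⟨f, e₀, he₀, hne⟩ := hA
    classical
    obtain ⟨l, -, hl⟩ := exists_addMonoidHom_int_separating (exponentHom d m)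
      (insert 0 (f : MixedLaurent k d m).coeff.support)
    have hinj : ∀ e ∈ insert 0 (f : MixedLaurent k d m).coeff.support, l e = l e₀ → e = e₀ :=
      fun e he h => exponentHom_injective d m (hl e he e₀ (Finset.mem_insert_of_mem he₀) h)
    refine exists_fractionRing_equiv_of_algHom_ratFunc (ι := Empty) (K := k)
      ((monomialAlgHom k 1 l).comp A.val) (fun i => i.elim) (fun i => i.elim) (fun i => i.elim)
      (algebraicIndependent_empty_type_iff.2 (algebraMap k k).injective) ?_ f
      (monomialAlgHom_ne_C 1 l (f : MixedLaurent k d m) (l e₀) ?_ ?_) (by simpa using htr)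
    · exact Subsingleton.elim _ _
    · intro h
      exact hne (hinj 0 (Finset.mem_insert_self _ _) (by rw [map_zero, h])).symm
    · rw [Finset.sum_eq_single e₀]
      · simpa using he₀
      · intro e he hee
        rw [Finset.mem_filter] at he
        exact absurd (hinj e (Finset.mem_insert_of_mem he.1) he.2) hee
      · simp [he₀]

theorem MixedLaurent.exists_fractionRing_equiv_of_single_mem {k : Type*} [Field k] {d m : ℕ}
    {A : Subalgebra k (MixedLaurent k d m)} (φ : MixedLaurent k d m →ₐ[k] A)
    (hφ : ∀ a : A, φ (a : MixedLaurent k d m) = a) (v a : Fin d → ℤ) (hva : ∑ i, v i * a i = 1)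
    (hv : (AddMonoidAlgebra.single (v, 0) 1 : MixedLaurent k d m) ∈ A)
    (htr : trdeg k A ≤ 2) (htr' : 1 ≤ trdeg k A) :
    ∃ t : ℕ, (t : Cardinal) = trdeg k A ∧
      Nonempty (FractionRing A ≃ₐ[k] FractionRing (MvPolynomial (Fin t) k)) := by
  let p : ((Fin d → ℤ) × (Fin m → ℕ)) →+ ℤ :=
    { toFun := fun e => ∑ i, e.1 i * a i
      map_zero' := by simp
      map_add' := fun x y => by simp [add_mul, Finset.sum_add_distrib] }
  have hp : p (v, 0) = 1 := hva
  let q : ((Fin d → ℤ) × (Fin m → ℕ)) →+ (Fin d ⊕ Fin m → ℤ) :=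
    exponentHom d m - (zmultiplesHom _ (exponentHom d m (v, 0))).comp p
  have hq : ∀ e, q e = exponentHom d m e - p e • exponentHom d m (v, 0) := fun _ => rfl
  have hqv : q (v, 0) = 0 := by rw [hq, hp, one_smul, sub_self]
  by_cases hA : ∀ f : A, ∀ e ∈ (f : MixedLaurent k d m).coeff.support, q e = 0
  · let g := (IsScalarTower.toAlgHom k A (FractionRing A)).comp φ
    refine exists_fractionRing_equiv_of_adjoin_eq_top (ι := Unit)
      (fun _ => g (AddMonoidAlgebra.single (v, 0) 1)) ?_ (by simpa using htr')
    refine eq_top_of_forall_algebraMap_mem _ fun f => ?_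
    rw [← hφ f]
    refine map_mem_of_support g _ f fun e he => ?_
    have h1 : e = (p e • v, 0) := by
      apply exponentHom_injective d m
      rw [sub_eq_zero.1 ((hq e).symm.trans (hA f e he))]
      ext (i | i) <;> simp [exponentHom]
    rw [h1]
    exact single_zsmul_mem g _ v (IntermediateField.subset_adjoin k _ (Set.mem_range_self ())) _
  · push Not at hA
    obtain ⟨f, e₀, he₀, hne⟩ := hA
    classical
    obtain ⟨l, hlq, hl⟩ := exists_addMonoidHom_int_separating q
      (insert 0 (f : MixedLaurent k d m).coeff.support)
    let χ : Multiplicative ((Fin d → ℤ) × (Fin m → ℕ)) →* RatFunc k :=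
      { toFun := fun e => RatFunc.X ^ p e.toAdd
        map_one' := by simp
        map_mul' := fun x y => by rw [toAdd_mul, map_add, zpow_add₀ RatFunc.X_ne_zero] }
    refine exists_fractionRing_equiv_of_algHom_ratFunc (ι := Unit) (K := RatFunc k)
      ((monomialAlgHom k χ l).comp A.val) (fun _ => (⟨_, hv⟩ : A))
      (fun _ => (RatFunc.X : RatFunc k)) (fun _ => ?_) ?_ ?_ f (monomialAlgHom_ne_C χ l (f : MixedLaurent k d m) (l e₀) ?_ ?_)
      (by simpa [one_add_one_eq_two] using htr)
    · rw [AlgHom.comp_apply, Subalgebra.coe_val, monomialAlgHom_single, hlq _ hqv]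
      simp [χ, hp]
    · rw [algebraicIndependent_unique_type_iff]
      exact RatFunc.transcendental_X
    · rw [Set.range_const]
      exact RatFunc.adjoin_X
    · intro h
      apply hne
      rw [hl e₀ (Finset.mem_insert_of_mem he₀) 0 (Finset.mem_insert_self _ _) (by rw [h, map_zero]),
        map_zero]
    · intro h
      have h2 := ratFunc_coeff_sum_C_mul_X_zpow
        ((f : MixedLaurent k d m).coeff.support.filter fun e => l e = l e₀)
        (fun e => (f : MixedLaurent k d m).coeff e) p (p e₀)
      have h3 : ∀ e, algebraMap k (RatFunc k) ((f : MixedLaurent k d m).coeff e) *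
          χ (Multiplicative.ofAdd e) =
          RatFunc.C ((f : MixedLaurent k d m).coeff e) * RatFunc.X ^ p e := fun e => rfl
      simp_rw [h3] at h
      rw [h, map_zero, Finset.filter_filter, Finset.sum_eq_single e₀] at h2
      · exact Finsupp.mem_support_iff.1 he₀ (by simpa using h2.symm)
      · intro e he hee
        rw [Finset.mem_filter] at he
        refine absurd (exponentHom_injective d m ?_) hee
        have := hl e (Finset.mem_insert_of_mem he.1) e₀ (Finset.mem_insert_of_mem he₀) he.2.1
        rwa [hq, hq, he.2.2, sub_left_inj] at this
      · intro h4
        exact absurd (Finset.mem_filter.2 ⟨he₀, rfl, rfl⟩) h4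

/-- Let `k` be a field, `1 ≤ d ≤ n ≤ 3` (with `n = d + m`),
`B = k[x₁^{±1}, …, x_d^{±1}, x_{d+1}, …, xₙ]` and `A` a `k`-subalgebra of `B` which is a
`k`-retract of `B`.  Then the fraction field `Q(A)` is rational over `k`: it is
`k`-isomorphic to the rational function field `k(t₁, …, t_t)` in `t = tr.deg_k A`
variables. -/
theorem retract_fraction_field_rational_low_dim (k : Type*) [Field k] (d m : ℕ) (hd : 1 ≤ d)
    (hn : d + m ≤ 3)
    (A : Subalgebra k (MixedLaurent k d m))
    (φ : MixedLaurent k d m →ₐ[k] A) (hφ : ∀ a : A, φ (a : MixedLaurent k d m) = a) :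
    ∃ t : ℕ, (t : Cardinal) = trdeg k A ∧
      Nonempty (FractionRing A ≃ₐ[k] FractionRing (MvPolynomial (Fin t) k)) := by
  let g := (IsScalarTower.toAlgHom k A (FractionRing A)).comp φ
  let x := fun i => g (AddMonoidAlgebra.single (MixedLaurent.varExponent d m i) 1)
  have hx := MixedLaurent.retract_eq_top_of_varExponent φ hφ
  rcases le_or_gt (trdeg k A) 1 with h1 | h1
  · exact MixedLaurent.exists_fractionRing_equiv_of_trdeg_le_one A h1
  have h2' : 2 ≤ trdeg k A := by
    rw [← one_add_one_eq_two]
    exact Cardinal.add_one_le_of_lt h1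
  rcases le_or_gt (trdeg k A) 2 with h2 | h2
  · by_cases hc : ∃ c : k, φ (AddMonoidAlgebra.single (Pi.single ⟨0, hd⟩ 1, 0) 1) =
        algebraMap k A c
    · obtain ⟨c, hc⟩ := hc
      refine exists_fractionRing_equiv_of_adjoin_eq_top
        (fun i : {i : Fin d ⊕ Fin m // i ≠ Sum.inl ⟨0, hd⟩} => x i) (hx _ fun i => ?_)
        (le_trans ?_ h2')
      · by_cases hi : i = Sum.inl ⟨0, hd⟩
        · subst hi
          change algebraMap A _ (φ (AddMonoidAlgebra.single (Pi.single ⟨0, hd⟩ 1, 0) 1)) ∈ _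
          rw [hc, ← IsScalarTower.algebraMap_apply]
          exact IntermediateField.algebraMap_mem _ _
        · exact subset_adjoin k _ ⟨⟨i, hi⟩, rfl⟩
      · have : Nat.card {i : Fin d ⊕ Fin m // i ≠ Sum.inl ⟨0, hd⟩} ≤ 2 := by
          simp
          omega
        exact_mod_cast this
    · push Not at hc
      obtain ⟨v, a, hva, hv⟩ := MixedLaurent.exists_single_mem φ hφ _ hc
      exact MixedLaurent.exists_fractionRing_equiv_of_single_mem φ hφ v a hva hv h2 h1.le
  · refine exists_fractionRing_equiv_of_adjoin_eq_top x
      (hx _ fun i => subset_adjoin k _ ⟨i, rfl⟩) (le_trans ?_ (Cardinal.add_one_le_of_lt h2))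
    have : Nat.card (Fin d ⊕ Fin m) ≤ 3 := by simpa using hn
    calc (Nat.card (Fin d ⊕ Fin m) : Cardinal) ≤ ((3 : ℕ) : Cardinal) := by exact_mod_cast this
      _ = 2 + 1 := by norm_num
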